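/- arXiv:2406.05028 — 5 statements merged into one kernel-verified Lean document; each statement's English description precedes it below -/
import Mathlib

section
/- Let u_SC, z_SC ∈ V be arbitrary, and suppose there are enhanced approximations û, ẑ ∈ V and a constant q ∈ [0,1) satisfying the saturation bounds ‖u − û‖ ≤ q·‖u − u_SC‖ and ‖z − ẑ‖ ≤ q·‖z − z_SC‖. Then the error in the corrected goal approximation satisfies |Q(u) − Q̃(u_SC, z_SC)| ≤ a_max·(1 − q)^{-2}·[ (C_goal/2)·‖û − u_SC‖² + ‖û − u_SC‖·‖ẑ − z_SC‖ ]. -/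
open MeasureTheory

/-- Under the saturation bounds for enhanced primal/dual approximations,
the corrected goal approximation error satisfies
`|Q(u) − Q̃(u_SC, z_SC)| ≤ a_max·(1−q)⁻²·[(C_goal/2)·‖û − u_SC‖² + ‖û − u_SC‖·‖ẑ − z_SC‖]`. -/
theorem stmt_0 {V : Type*} [NormedAddCommGroup V] [InnerProductSpace ℝ V] [CompleteSpace V]
    (B : V →ₗ[ℝ] V →ₗ[ℝ] ℝ)
    (hsymm : ∀ v w : V, B v w = B w v)
    (a_max a_min : ℝ) (ha_max : 0 < a_max) (ha_min : 0 < a_min)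
    (hbdd : ∀ v w : V, |B v w| ≤ a_max * ‖v‖ * ‖w‖)
    (hcoer : ∀ v : V, a_min * ‖v‖ ^ 2 ≤ B v v)
    (Q : V → ℝ) (Q' : V → (V →L[ℝ] ℝ)) (hQ'cont : Continuous Q')
    (hgateaux : ∀ x v : V, HasDerivAt (fun t : ℝ => Q (x + t • v)) (Q' x v) 0)
    (C_goal : ℝ) (hC_goal : 0 ≤ C_goal)
    (hgoal : ∀ v w x : V, |(Q' v - Q' w) x| ≤
      C_goal * Real.sqrt (B (v - w) (v - w)) * Real.sqrt (B x x))
    (F : V →L[ℝ] ℝ) (u z : V)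
    (hprimal : ∀ v : V, B u v = F v)
    (hdual : ∀ v : V, B v z = Q' u v)
    (uSC zSC uhat zhat : V) (q : ℝ) (hq0 : 0 ≤ q) (hq1 : q < 1)
    (hsatu : ‖u - uhat‖ ≤ q * ‖u - uSC‖)
    (hsatz : ‖z - zhat‖ ≤ q * ‖z - zSC‖) :
    |Q u - (Q uSC + B (u - uSC) zSC)| ≤
      a_max * ((1 - q)⁻¹) ^ 2 *
        (C_goal / 2 * ‖uhat - uSC‖ ^ 2 + ‖uhat - uSC‖ * ‖zhat - zSC‖) := by
  have hcB : ∀ v : V, 0 ≤ B v v := fun v => le_trans (by positivity) (hcoer v)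
  have hq : 0 < 1 - q := by linarith
  -- saturation consequence
  have sat : ∀ a b c : V, ‖a - b‖ ≤ q * ‖a - c‖ → ‖a - c‖ ≤ (1 - q)⁻¹ * ‖b - c‖ := by
    intro a b c h
    have h1 : ‖a - c‖ ≤ ‖a - b‖ + ‖b - c‖ := norm_sub_le_norm_sub_add_norm_sub a b c
    rw [inv_mul_eq_div, le_div_iff₀ hq]
    nlinarith
  have hu := sat u uhat uSC hsatu
  have hz := sat z zhat zSC hsatz
  obtain ⟨d, hd⟩ : ∃ d, d = uSC - u := ⟨_, rfl⟩
  have hderiv : ∀ t : ℝ, HasDerivAt (fun t : ℝ => Q (u + t • d)) (Q' (u + t • d) d) t := by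
    intro t
    have h := hgateaux (u + t • d) d
    have h2 : HasDerivAt (fun s : ℝ => s - t) 1 t := (hasDerivAt_id t).sub_const t
    have h3 : HasDerivAt (fun s : ℝ => Q (u + t • d + s • d)) (Q' (u + t • d) d) (t - t) := by
      rw [sub_self]; exact h
    have h4 := HasDerivAt.comp (h := fun s : ℝ => s - t) t h3 h2
    rw [mul_one] at h4
    refine h4.congr_of_eventuallyEq (Filter.Eventually.of_forall fun s => ?_)
    simp only [Function.comp]
    congr 1
    module
  have hf : ∀ t : ℝ, HasDerivAt (fun t : ℝ => Q (u + t • d) - Q u - t * Q' u d)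
      (Q' (u + t • d) d - Q' u d) t := by
    intro t
    have h := ((hderiv t).sub_const (Q u)).sub ((hasDerivAt_id t).mul_const (Q' u d))
    rw [one_mul] at h
    exact h
  have hb : ∀ t : ℝ, HasDerivAt (fun t : ℝ => C_goal / 2 * B d d * t ^ 2)
      (C_goal * B d d * t) t := by
    intro t
    have h := (hasDerivAt_pow 2 t).const_mul (C_goal / 2 * B d d)
    refine h.congr_deriv ?_
    norm_num
    ring
  have key := image_norm_le_of_norm_deriv_right_le_deriv_boundary
    (f := fun t : ℝ => Q (u + t • d) - Q u - t * Q' u d)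
    (f' := fun t : ℝ => Q' (u + t • d) d - Q' u d) (a := 0) (b := 1)
    (B := fun t : ℝ => C_goal / 2 * B d d * t ^ 2) (B' := fun t => C_goal * B d d * t)
    (fun t _ => (hf t).continuousAt.continuousWithinAt)
    (fun t _ => (hf t).hasDerivWithinAt) (by simp) hb
    (by
      intro t ht
      have h := hgoal (u + t • d) u d
      have e : B (u + t • d - u) (u + t • d - u) = t ^ 2 * B d d := by
        rw [add_sub_cancel_left]
        simp only [map_smul, LinearMap.smul_apply, smul_eq_mul]
        ring
      rw [e, Real.sqrt_mul (sq_nonneg t), Real.sqrt_sq ht.1] at h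
      have h5 := Real.mul_self_sqrt (hcB d)
      rw [Real.norm_eq_abs]
      calc _ ≤ _ := h
        _ = C_goal * (√(B d d) * √(B d d)) * t := by ring
        _ = _ := by rw [h5])
    (x := 1) (by simp)
  have hud : u + d = uSC := by rw [hd]; abel
  simp only [one_smul, one_mul, one_pow, mul_one, Real.norm_eq_abs, hud] at key
  have hnd : ‖d‖ = ‖u - uSC‖ := by rw [hd, norm_sub_rev]
  have hBd : B d d ≤ a_max * ‖u - uSC‖ * ‖u - uSC‖ := by
    have := (le_abs_self _).trans (hbdd d d)
    rwa [hnd] at this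
  have hB2 := hbdd (u - uSC) (z - zSC)
  have heq : Q u - (Q uSC + B (u - uSC) zSC)
      = -(Q uSC - Q u - Q' u d) + B (u - uSC) (z - zSC) := by
    rw [← hdual d, hd]
    simp only [map_sub, LinearMap.sub_apply]
    ring
  rw [heq]
  have ht := abs_add_le (-(Q uSC - Q u - Q' u d)) (B (u - uSC) (z - zSC))
  rw [abs_neg] at ht
  have n1 := norm_nonneg (u - uSC)
  have hi : 0 < (1 - q)⁻¹ := inv_pos.mpr hq
  calc _ ≤ _ := ht
    _ ≤ C_goal / 2 * (a_max * ‖u - uSC‖ * ‖u - uSC‖) + a_max * ‖u - uSC‖ * ‖z - zSC‖ := by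
        refine add_le_add (key.trans ?_) hB2
        gcongr
    _ ≤ C_goal / 2 * (a_max * ((1 - q)⁻¹ * ‖uhat - uSC‖) * ((1 - q)⁻¹ * ‖uhat - uSC‖))
        + a_max * ((1 - q)⁻¹ * ‖uhat - uSC‖) * ((1 - q)⁻¹ * ‖zhat - zSC‖) := by
        gcongr
    _ = _ := by ring
end

section
/- For any u_SC, z_SC ∈ V, the error in the corrected goal approximation satisfies |Q(u) − Q̃(u_SC, z_SC)| ≤ (C_goal/2)·|||u − u_SC|||² + |||u − u_SC|||·|||z − z_SC|||. -/
/-- `|Q(u) − Q̃(u_SC, z_SC)| ≤ (C_goal/2)·|||u − u_SC|||² + |||u − u_SC|||·|||z − z_SC|||`,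
where `|||v||| = √(B v v)` is the energy norm. -/
theorem stmt_1 {V : Type*} [NormedAddCommGroup V] [InnerProductSpace ℝ V] [CompleteSpace V]
    (B : V →ₗ[ℝ] V →ₗ[ℝ] ℝ)
    (hsymm : ∀ v w : V, B v w = B w v)
    (a_max a_min : ℝ) (ha_max : 0 < a_max) (ha_min : 0 < a_min)
    (hbdd : ∀ v w : V, |B v w| ≤ a_max * ‖v‖ * ‖w‖)
    (hcoer : ∀ v : V, a_min * ‖v‖ ^ 2 ≤ B v v)
    (Q : V → ℝ) (Q' : V → (V →L[ℝ] ℝ)) (hQ'cont : Continuous Q')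
    (hgateaux : ∀ x v : V, HasDerivAt (fun t : ℝ => Q (x + t • v)) (Q' x v) 0)
    (C_goal : ℝ) (hC_goal : 0 ≤ C_goal)
    (hgoal : ∀ v w x : V, |(Q' v - Q' w) x| ≤
      C_goal * Real.sqrt (B (v - w) (v - w)) * Real.sqrt (B x x))
    (F : V →L[ℝ] ℝ) (u z : V)
    (hprimal : ∀ v : V, B u v = F v)
    (hdual : ∀ v : V, B v z = Q' u v)
    (uSC zSC : V) :
    |Q u - (Q uSC + B (u - uSC) zSC)| ≤
      C_goal / 2 * Real.sqrt (B (u - uSC) (u - uSC)) ^ 2 +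
        Real.sqrt (B (u - uSC) (u - uSC)) * Real.sqrt (B (z - zSC) (z - zSC)) := by
  have hnn : ∀ v : V, 0 ≤ B v v := fun v => le_trans (by positivity) (hcoer v)
  have hCS : ∀ v w : V, |B v w| ≤ Real.sqrt (B v v) * Real.sqrt (B w w) := by
    intro v w
    rw [← Real.sqrt_mul (hnn v)]
    apply Real.abs_le_sqrt
    have h : ∀ t : ℝ, 0 ≤ B w w * (t * t) + (2 * B v w) * t + B v v := by
      intro t
      have h1 := hnn (v + t • w)
      simp only [map_add, map_smul, LinearMap.add_apply, LinearMap.smul_apply, smul_eq_mul] at h1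
      rw [hsymm w v] at h1
      linarith
    have h2 := discrim_le_zero h
    unfold discrim at h2
    nlinarith
  set E := Real.sqrt (B (u - uSC) (u - uSC)) with hE
  have hE0 : 0 ≤ E := Real.sqrt_nonneg _
  have hsc : ∀ t : ℝ, 0 ≤ t →
      Real.sqrt (B (t • (u - uSC)) (t • (u - uSC))) = t * E := by
    intro t ht
    simp only [map_smul, LinearMap.smul_apply, smul_eq_mul]
    rw [← mul_assoc, Real.sqrt_mul (mul_nonneg ht ht), Real.sqrt_mul_self ht]
  have hder : ∀ t : ℝ, HasDerivAt (fun t : ℝ => Q (u + t • (uSC - u)))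
      (Q' (u + t • (uSC - u)) (uSC - u)) t := by
    intro t
    have h1 := hgateaux (u + t • (uSC - u)) (uSC - u)
    have h1' : HasDerivAt (fun s : ℝ => Q (u + t • (uSC - u) + s • (uSC - u)))
      (Q' (u + t • (uSC - u)) (uSC - u)) (t - t) := by simpa using h1
    have h2 := h1'.comp_sub_const t t
    refine h2.congr_of_eventuallyEq (Filter.Eventually.of_forall fun s => ?_)
    simp only [sub_smul, add_assoc]
    congr 2
    abel
  have hder2 : ∀ t : ℝ, HasDerivAt
      (fun t : ℝ => Q (u + t • (uSC - u)) - Q u - t * Q' u (uSC - u))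
      ((Q' (u + t • (uSC - u)) - Q' u) (uSC - u)) t := by
    intro t
    have := ((hder t).sub_const (Q u)).sub ((hasDerivAt_id t).mul_const (Q' u (uSC - u)))
    rw [one_mul] at this
    exact this
  have hB : ∀ t : ℝ, HasDerivAt (fun t : ℝ => C_goal * E ^ 2 / 2 * t ^ 2)
      (C_goal * E ^ 2 * t) t := by
    intro t
    have := (hasDerivAt_pow 2 t).const_mul (C_goal * E ^ 2 / 2)
    have e : C_goal * E ^ 2 * t = C_goal * E ^ 2 / 2 * (((2 : ℕ) : ℝ) * t ^ (2 - 1)) := by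
      norm_num
      ring
    rw [e]
    exact this
  have hT := image_norm_le_of_norm_deriv_right_le_deriv_boundary (a := (0:ℝ)) (b := 1)
    (fun t _ => (hder2 t).continuousAt.continuousWithinAt)
    (fun t _ => (hder2 t).hasDerivWithinAt) (by simp) hB (by
      intro t ht
      have h1 := hgoal (u + t • (uSC - u)) u (uSC - u)
      have e1 : u + t • (uSC - u) - u = -(t • (u - uSC)) := by
        rw [add_sub_cancel_left, ← smul_neg, neg_sub]
      have e2 : B (uSC - u) (uSC - u) = B (u - uSC) (u - uSC) := by
        rw [← neg_sub u uSC]; simp only [map_neg, LinearMap.neg_apply, neg_neg]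
      have e3 : B (-(t • (u - uSC))) (-(t • (u - uSC))) = B (t • (u - uSC)) (t • (u - uSC)) := by
        simp only [map_neg, LinearMap.neg_apply, neg_neg]
      rw [e1, e3, hsc t ht.1, e2, ← hE] at h1
      rw [Real.norm_eq_abs]
      linarith) (Set.right_mem_Icc.2 zero_le_one)
  have hC := hCS (u - uSC) (z - zSC)
  rw [← hE, map_sub, hdual] at hC
  simp only [one_smul, add_sub_cancel, one_mul, Real.norm_eq_abs, one_pow, mul_one] at hT
  have e4 : Q' u (uSC - u) = - Q' u (u - uSC) := by rw [← map_neg, neg_sub]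
  rw [e4] at hT
  rw [abs_le] at *
  constructor <;> linarith [hT.1, hT.2, hC.1, hC.2]
end

section
/- For any u_SC, z_SC ∈ V, the goal error admits the representation Q(u) − Q̃(u_SC, z_SC) = ∫₀¹ ⟨Q'(u_SC + t·(u − u_SC)) − Q'(u), u − u_SC⟩ dt + B(u − u_SC, z − z_SC). -/
/-- the exact goal-error representation
`Q(u) − Q̃(u_SC, z_SC) = ∫₀¹ ⟨Q'(u_SC + t(u − u_SC)) − Q'(u), u − u_SC⟩ dt + B(u − u_SC, z − z_SC)`. -/
theorem stmt_2 {V : Type*} [NormedAddCommGroup V] [InnerProductSpace ℝ V] [CompleteSpace V]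
    (B : V →ₗ[ℝ] V →ₗ[ℝ] ℝ)
    (hsymm : ∀ v w : V, B v w = B w v)
    (a_max a_min : ℝ) (ha_max : 0 < a_max) (ha_min : 0 < a_min)
    (hbdd : ∀ v w : V, |B v w| ≤ a_max * ‖v‖ * ‖w‖)
    (hcoer : ∀ v : V, a_min * ‖v‖ ^ 2 ≤ B v v)
    (Q : V → ℝ) (Q' : V → (V →L[ℝ] ℝ)) (hQ'cont : Continuous Q')
    (hgateaux : ∀ x v : V, HasDerivAt (fun t : ℝ => Q (x + t • v)) (Q' x v) 0)
    (F : V →L[ℝ] ℝ) (u z : V)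
    (hprimal : ∀ v : V, B u v = F v)
    (hdual : ∀ v : V, B v z = Q' u v)
    (uSC zSC : V) :
    Q u - (Q uSC + B (u - uSC) zSC) =
      (∫ t in (0:ℝ)..1, (Q' (uSC + t • (u - uSC)) - Q' u) (u - uSC)) +
        B (u - uSC) (z - zSC) := by
  have hd : ∀ t : ℝ, HasDerivAt (fun s : ℝ => Q (uSC + s • (u - uSC)))
      (Q' (uSC + t • (u - uSC)) (u - uSC)) t := by
    intro t
    have h := hgateaux (uSC + t • (u - uSC)) (u - uSC)
    have h0 : HasDerivAt (fun s : ℝ => Q (uSC + t • (u - uSC) + s • (u - uSC)))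
        (Q' (uSC + t • (u - uSC)) (u - uSC)) (t - t) := by
      rw [sub_self]; exact h
    have h2 := h0.comp_sub_const t t
    refine h2.congr_of_eventuallyEq (Filter.Eventually.of_forall fun s => ?_)
    have : uSC + t • (u - uSC) + (s - t) • (u - uSC) = uSC + s • (u - uSC) := by
      module
    simp only [this]
  have hc : Continuous fun t : ℝ => Q' (uSC + t • (u - uSC)) (u - uSC) := by
    have : Continuous fun t : ℝ => Q' (uSC + t • (u - uSC)) := hQ'cont.comp (by fun_prop)
    exact this.clm_apply continuous_const
  have hint := intervalIntegral.integral_eq_sub_of_hasDerivAt (fun t _ => hd t)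
    (hc.intervalIntegrable 0 1)
  simp only [ContinuousLinearMap.sub_apply]
  rw [intervalIntegral.integral_sub (hc.intervalIntegrable 0 1) (by simp), hint]
  have h1 : uSC + (1 : ℝ) • (u - uSC) = u := by module
  have h3 : uSC + (0 : ℝ) • (u - uSC) = uSC := by module
  rw [h1, h3, intervalIntegral.integral_const, map_sub (B (u - uSC)), hdual (u - uSC)]
  simp only [sub_zero, one_smul]
  ring
end

section
/- For any u_SC, z_SC ∈ V, the error in the corrected goal approximation satisfies |Q(u) − Q̃(u_SC, z_SC)| ≤ |||u − u_SC|||·|||z − z_SC|||, and hence also |Q(u) − Q̃(u_SC, z_SC)| ≤ a_max·‖u − u_SC‖·‖z − z_SC‖. -/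
/-- `|Q(u) − Q̃(u_SC, z_SC)| ≤ |||u − u_SC|||·|||z − z_SC|||`, and hence also
`|Q(u) − Q̃(u_SC, z_SC)| ≤ a_max·‖u − u_SC‖·‖z − z_SC‖`. -/
theorem stmt_9 {V : Type*} [NormedAddCommGroup V] [InnerProductSpace ℝ V] [CompleteSpace V]
    (B : V →ₗ[ℝ] V →ₗ[ℝ] ℝ)
    (hsymm : ∀ v w : V, B v w = B w v)
    (a_max a_min : ℝ) (ha_max : 0 < a_max) (ha_min : 0 < a_min)
    (hbdd : ∀ v w : V, |B v w| ≤ a_max * ‖v‖ * ‖w‖)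
    (hcoer : ∀ v : V, a_min * ‖v‖ ^ 2 ≤ B v v)
    (F Q : V →L[ℝ] ℝ) (u z : V)
    (hprimal : ∀ v : V, B u v = F v)
    (hdual : ∀ v : V, B v z = Q v)
    (uSC zSC : V) :
    |Q u - (Q uSC + F zSC - B uSC zSC)| ≤
      Real.sqrt (B (u - uSC) (u - uSC)) * Real.sqrt (B (z - zSC) (z - zSC)) ∧
    |Q u - (Q uSC + F zSC - B uSC zSC)| ≤ a_max * ‖u - uSC‖ * ‖z - zSC‖ := by
  have key : Q u - (Q uSC + F zSC - B uSC zSC) = B (u - uSC) (z - zSC) := by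
    simp only [← hprimal, ← hdual, map_sub, LinearMap.sub_apply]
    ring
  have hnn : ∀ v : V, 0 ≤ B v v := fun v => le_trans (by positivity) (hcoer v)
  rw [key]
  refine ⟨?_, hbdd _ _⟩
  generalize u - uSC = v
  generalize z - zSC = w
  have hd : discrim (B v v) (2 * B v w) (B w w) ≤ 0 := by
    apply discrim_le_zero
    intro t
    have h := hnn (t • v + w)
    simp only [map_add, map_smul, LinearMap.add_apply, LinearMap.smul_apply, smul_eq_mul,
      hsymm w v] at h
    linarith
  rw [← Real.sqrt_mul (hnn v)]
  apply Real.abs_le_sqrt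
  unfold discrim at hd
  linarith
end

section
/- Let u_SC, z_SC ∈ V be arbitrary, and suppose there are enhanced approximations û, ẑ ∈ V and a constant q ∈ [0,1) satisfying the saturation bounds ‖u − û‖ ≤ q·‖u − u_SC‖ and ‖z − ẑ‖ ≤ q·‖z − z_SC‖. Then |Q(u) − Q̃(u_SC, z_SC)| ≤ a_max·(1 − q)^{-2}·‖û − u_SC‖·‖ẑ − z_SC‖. -/
/-- under the saturation bounds with constant `q ∈ [0,1)`,
`|Q(u) − Q̃(u_SC, z_SC)| ≤ a_max·(1 − q)⁻²·‖û − u_SC‖·‖ẑ − z_SC‖`. -/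
theorem stmt_10 {V : Type*} [NormedAddCommGroup V] [InnerProductSpace ℝ V] [CompleteSpace V]
    (B : V →ₗ[ℝ] V →ₗ[ℝ] ℝ)
    (hsymm : ∀ v w : V, B v w = B w v)
    (a_max a_min : ℝ) (ha_max : 0 < a_max) (ha_min : 0 < a_min)
    (hbdd : ∀ v w : V, |B v w| ≤ a_max * ‖v‖ * ‖w‖)
    (hcoer : ∀ v : V, a_min * ‖v‖ ^ 2 ≤ B v v)
    (F Q : V →L[ℝ] ℝ) (u z : V)
    (hprimal : ∀ v : V, B u v = F v)
    (hdual : ∀ v : V, B v z = Q v)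
    (uSC zSC uhat zhat : V) (q : ℝ) (hq0 : 0 ≤ q) (hq1 : q < 1)
    (hsatu : ‖u - uhat‖ ≤ q * ‖u - uSC‖)
    (hsatz : ‖z - zhat‖ ≤ q * ‖z - zSC‖) :
    |Q u - (Q uSC + F zSC - B uSC zSC)| ≤
      a_max * ((1 - q)⁻¹) ^ 2 * (‖uhat - uSC‖ * ‖zhat - zSC‖) := by
  have key : ∀ a b c : V, ‖a - b‖ ≤ q * ‖a - c‖ → ‖a - c‖ ≤ (1 - q)⁻¹ * ‖b - c‖ := by
    intro a b c h
    have h1 : 0 < 1 - q := by linarith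
    have h2 := norm_sub_le_norm_sub_add_norm_sub a b c
    rw [inv_mul_eq_div, le_div_iff₀ h1]
    linarith
  have e : Q u - (Q uSC + F zSC - B uSC zSC) = B (u - uSC) (z - zSC) := by
    rw [← hdual, ← hdual, ← hprimal]
    simp only [map_sub, LinearMap.sub_apply]
    ring
  have hu := key _ _ _ hsatu
  have hz := key _ _ _ hsatz
  rw [e]
  calc |B (u - uSC) (z - zSC)| ≤ a_max * ‖u - uSC‖ * ‖z - zSC‖ := hbdd _ _
    _ = a_max * (‖u - uSC‖ * ‖z - zSC‖) := by ring
    _ ≤ a_max * (((1 - q)⁻¹ * ‖uhat - uSC‖) * ((1 - q)⁻¹ * ‖zhat - zSC‖)) := by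
        apply mul_le_mul_of_nonneg_left _ ha_max.le
        exact mul_le_mul hu hz (norm_nonneg _) ((norm_nonneg _).trans hu)
    _ = a_max * ((1 - q)⁻¹) ^ 2 * (‖uhat - uSC‖ * ‖zhat - zSC‖) := by ring
end
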